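/- Let K be the attractor of an IFS of similitudes on a complete metric space, endowed with its natural fractal structure. If the natural fractal structure is irreducible, then (LSP2) holds, i.e., int_K(A_𝐢) ≠ ∅ for every word 𝐢, and moreover whenever A_𝐢 ⊆ A_𝐣 for words 𝐢 ∈ Σ^n, 𝐣 ∈ Σ^m, the word 𝐣 is a prefix of 𝐢. -/

import Mathlib

open scoped ENNReal

namespace IFSMoran

variable {X : Type*} [MetricSpace X]

/-- The map `f_i = f_{i1} o ... o f_{in}` associated to a word `i = i1...in`
(a list of indices). -/
def wMap {k : ℕ} (f : Fin k → X → X) : List (Fin k) → X → X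
  | [] => id
  | i :: w => f i ∘ wMap f w

/-- The piece `A_i = f_i(K)` of the natural fractal structure. -/
def piece {k : ℕ} (f : Fin k → X → X) (K : Set X) (w : List (Fin k)) : Set X :=
  wMap f w '' K

/-- The natural fractal structure (levels indexed by words) is irreducible:
no level admits a proper subcovering. -/
def Irred {k : ℕ} (f : Fin k → X → X) (K : Set X) : Prop :=
  ∀ w : List (Fin k),
    ¬ piece f K w ⊆ ⋃ v ∈ {v : List (Fin k) | v.length = w.length ∧ v ≠ w}, piece f K v

/-- `H³ₙˢ(K) = inf_{l ≥ n} ∑_{i ∈ Σˡ} diam (A_i) ^ s`. -/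
noncomputable def H3n {k : ℕ} (f : Fin k → X → X) (K : Set X) (s : ℝ) (n : ℕ) : ℝ≥0∞ :=
  ⨅ (l : ℕ) (_ : n ≤ l),
    ∑ w : Fin l → Fin k, EMetric.diam (piece f K (List.ofFn w)) ^ s

/-- `H³ˢ(K) = lim_n H³ₙˢ(K)`; the sequence is nondecreasing in `n`, so the limit
is the supremum. -/
noncomputable def H3 {k : ℕ} (f : Fin k → X → X) (K : Set X) (s : ℝ) : ℝ≥0∞ :=
  ⨆ n, H3n f K s n

/-- Fractal dimension III: `dim³(K) = inf {s ≥ 0 : H³ˢ(K) = 0}`. -/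
noncomputable def dim3 {k : ℕ} (f : Fin k → X → X) (K : Set X) : ℝ :=
  sInf {s : ℝ | 0 ≤ s ∧ H3 f K s = 0}

/-- `H⁴ₙˢ(K)`: infimum of `∑ diam (A_i) ^ s` over finite coverings of `K` by
pieces indexed by words of length `≥ n`. -/
noncomputable def H4n {k : ℕ} (f : Fin k → X → X) (K : Set X) (s : ℝ) (n : ℕ) : ℝ≥0∞ :=
  ⨅ (𝒜 : Finset (List (Fin k))) (_ : ∀ w ∈ 𝒜, n ≤ w.length)
      (_ : K ⊆ ⋃ w ∈ 𝒜, piece f K w),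
    ∑ w ∈ 𝒜, EMetric.diam (piece f K w) ^ s

/-- `H⁴ˢ(K) = lim_n H⁴ₙˢ(K)`; the sequence is nondecreasing in `n`, so the limit
is the supremum. -/
noncomputable def H4 {k : ℕ} (f : Fin k → X → X) (K : Set X) (s : ℝ) : ℝ≥0∞ :=
  ⨆ n, H4n f K s n

/-- Fractal dimension IV: `dim⁴(K) = inf {s ≥ 0 : H⁴ˢ(K) = 0}`. -/
noncomputable def dim4 {k : ℕ} (f : Fin k → X → X) (K : Set X) : ℝ :=
  sInf {s : ℝ | 0 ≤ s ∧ H4 f K s = 0}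

/-- Interior of `A` relative to `K` (as a subset of the ambient space `X`). -/
def intK (K A : Set X) : Set X := K \ closure (K \ A)

/-- The level separation property: interiors (in `K`) of two pieces indexed by
distinct words of the same length are disjoint (LSP1), and every piece has
nonempty interior in `K` (LSP2). -/
def LSP {k : ℕ} (f : Fin k → X → X) (K : Set X) : Prop :=
  (∀ v w : List (Fin k), v.length = w.length → v ≠ w →
      intK K (piece f K v) ∩ intK K (piece f K w) = ∅) ∧
  ∀ w : List (Fin k), (intK K (piece f K w)).Nonempty

/-- The natural fractal structure is a tiling: pieces indexed by distinct words
of the same length have disjoint interiors in `K`, and every piece is regularly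
closed in `K`, i.e. `cl_K (int_K (A_i)) = A_i`. -/
def IsTiling {k : ℕ} (f : Fin k → X → X) (K : Set X) : Prop :=
  (∀ v w : List (Fin k), v.length = w.length → v ≠ w →
      intK K (piece f K v) ∩ intK K (piece f K w) = ∅) ∧
  ∀ w : List (Fin k), closure (intK K (piece f K w)) ∩ K = piece f K w


section Pieces

variable {k : ℕ} {f : Fin k → X → X} {K : Set X}

theorem wMap_append (u v : List (Fin k)) : wMap f (u ++ v) = wMap f u ∘ wMap f v := by
  induction u with
  | nil => rfl
  | cons i u ih => simp only [List.cons_append, wMap, ih, Function.comp_assoc]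

theorem piece_append (u v : List (Fin k)) :
    piece f K (u ++ v) = wMap f u '' piece f K v := by
  simp only [piece, wMap_append, Set.image_comp]

theorem continuous_wMap (hf : ∀ i, Continuous (f i)) (w : List (Fin k)) :
    Continuous (wMap f w) := by
  induction w with
  | nil => exact continuous_id
  | cons i w ih => exact (hf i).comp ih

theorem piece_subset_attractor (hK : K = ⋃ i, f i '' K) (w : List (Fin k)) :
    piece f K w ⊆ K := by
  induction w with
  | nil => simp [piece, wMap]
  | cons i w ih =>
    have h : piece f K (i :: w) = f i '' piece f K w := by
      simp only [piece, wMap, Set.image_comp]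
    rw [h]
    refine (Set.image_mono ih).trans ?_
    conv_rhs => rw [hK]
    exact Set.subset_iUnion (fun i => f i '' K) i

theorem piece_append_subset (hK : K = ⋃ i, f i '' K) (u v : List (Fin k)) :
    piece f K (u ++ v) ⊆ piece f K u := by
  rw [piece_append]
  exact Set.image_mono (piece_subset_attractor hK v)

theorem exists_mem_piece_of_length (hK : K = ⋃ i, f i '' K) (n : ℕ) {x : X} (hx : x ∈ K) :
    ∃ w : List (Fin k), w.length = n ∧ x ∈ piece f K w := by
  induction n generalizing x with
  | zero => exact ⟨[], rfl, x, hx, rfl⟩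
  | succ n ih =>
    rw [hK] at hx
    obtain ⟨i, y, hy, rfl⟩ := Set.mem_iUnion.1 hx
    obtain ⟨w, hw, z, hz, rfl⟩ := ih hy
    exact ⟨i :: w, by simp [hw], z, hz, rfl⟩

theorem Irred.intK_piece_nonempty (hirr : Irred f K) (hf : ∀ i, Continuous (f i))
    (hKcp : IsCompact K) (hK : K = ⋃ i, f i '' K) (w : List (Fin k)) :
    (intK K (piece f K w)).Nonempty := by
  obtain ⟨x, hxw, hx⟩ := Set.not_subset.1 (hirr w)
  refine ⟨x, piece_subset_attractor hK w hxw, fun hcl => hx ?_⟩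
  have hfin : {v : List (Fin k) | v.length = w.length ∧ v ≠ w}.Finite :=
    (List.finite_length_eq (Fin k) w.length).subset fun v hv => hv.1
  refine closure_minimal ?_ (hfin.isClosed_biUnion fun v _ =>
    (hKcp.image (continuous_wMap hf v)).isClosed) hcl
  rintro y ⟨hyK, hyw⟩
  obtain ⟨v, hv, hyv⟩ := exists_mem_piece_of_length hK w.length hyK
  exact Set.mem_biUnion (x := v) ⟨hv, fun h => hyw (h ▸ hyv)⟩ hyv

theorem Irred.isPrefix_of_length_le (hirr : Irred f K) (hK : K = ⋃ i, f i '' K)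
    {v w : List (Fin k)} (hlen : w.length ≤ v.length) (hvw : piece f K v ⊆ piece f K w) :
    w <+: v := by
  by_contra hpre
  refine hirr v fun x hx => ?_
  obtain ⟨y, hy, rfl⟩ := hvw hx
  obtain ⟨z, hz, hyz⟩ := exists_mem_piece_of_length hK (v.length - w.length) hy
  refine Set.mem_biUnion (x := w ++ z) ⟨?_, fun h => hpre ⟨z, h⟩⟩ ?_
  · rw [List.length_append, hz]
    omega
  · rw [piece_append]
    exact Set.mem_image_of_mem _ hyz

theorem Irred.isPrefix_of_piece_subset (hirr : Irred f K) (hk : 2 ≤ k) (hK : K = ⋃ i, f i '' K)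
    {v w : List (Fin k)} (hvw : piece f K v ⊆ piece f K w) : w <+: v := by
  rcases le_or_gt w.length v.length with hlen | hlen
  · exact hirr.isPrefix_of_length_le hK hlen hvw
  have key (i : Fin k) : w = v ++ List.replicate (w.length - v.length) i := by
    have hl : (v ++ List.replicate (w.length - v.length) i).length = w.length := by
      rw [List.length_append, List.length_replicate]
      omega
    exact (hirr.isPrefix_of_length_le hK hl.ge
      ((piece_append_subset hK _ _).trans hvw)).eq_of_length hl.symm
  have heq := List.append_cancel_left
    ((key ⟨0, by omega⟩).symm.trans (key ⟨1, by omega⟩))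
  have hd : w.length - v.length ≠ 0 := by omega
  simp [List.replicate_inj, hd] at heq

end Pieces

theorem stmt_10 {X : Type*} [MetricSpace X] [CompleteSpace X]
    {k : ℕ} (hk : 2 ≤ k) (f : Fin k → X → X) (c : Fin k → ℝ)
    (hc : ∀ i, c i ∈ Set.Ioo (0 : ℝ) 1)
    (hf : ∀ i x y, dist (f i x) (f i y) = c i * dist x y)
    (K : Set X) (hKne : K.Nonempty) (hKcp : IsCompact K)
    (hK : K = ⋃ i, f i '' K)
    (hirr : Irred f K) :
    (∀ w : List (Fin k), (intK K (piece f K w)).Nonempty) ∧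
      ∀ v w : List (Fin k), piece f K v ⊆ piece f K w → w <+: v := by
  have hcont (i : Fin k) : Continuous (f i) :=
    (LipschitzWith.of_dist_le_mul (K := ⟨c i, (hc i).1.le⟩)
      fun x y => (hf i x y).le).continuous
  exact ⟨hirr.intK_piece_nonempty hcont hKcp hK,
    fun _ _ => hirr.isPrefix_of_piece_subset hk hK⟩

end IFSMoran
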